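/- arXiv:1501.04668 — 4 statements merged into one kernel-verified Lean document; each statement's English description precedes it below -/
import Mathlib

section
/- Let f ∈ F(y) be shift-reduced with f ≠ 1. If a polynomial r ∈ F[y] satisfies f·σ(r) − r = 0, then r = 0. -/
open Polynomial

noncomputable def pshift (F : Type*) [Field F] (i : ℤ) :
    Polynomial F →ₐ[F] Polynomial F :=
  aeval (X + C (i : F))

noncomputable def rshift (F : Type*) [Field F] (i : ℤ) : RatFunc F → RatFunc F :=
  fun f => RatFunc.mk (pshift F i f.num) (pshift F i f.denom)

def shiftFree {F : Type*} [Field F] (p : Polynomial F) : Prop :=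
  p ≠ 0 ∧ ∀ i : ℤ, i ≠ 0 → IsCoprime p (pshift F i p)

def shiftReducedPair {F : Type*} [Field F] (u v : Polynomial F) : Prop :=
  u ≠ 0 ∧ v ≠ 0 ∧ IsCoprime u v ∧ ∀ i : ℤ, IsCoprime u (pshift F i v)

def stronglyPrime {F : Type*} [Field F] (p u v : Polynomial F) : Prop :=
  p ≠ 0 ∧ ∀ i : ℕ, IsCoprime p (pshift F (-(i : ℤ)) u) ∧ IsCoprime p (pshift F (i : ℤ) v)

noncomputable def phiK {F : Type*} [Field F] (u v : Polynomial F) :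
    Polynomial F → Polynomial F :=
  fun p => u * pshift F 1 p - v * p

noncomputable def WK (F : Type*) [Field F] (u v : Polynomial F) :
    Submodule F (Polynomial F) :=
  Submodule.span F {q : Polynomial F | ∃ ℓ : ℕ, q = X ^ ℓ ∧
    ∀ w : Polynomial F, w ∈ Set.range (phiK u v) → w ≠ 0 → ℓ ≠ w.natDegree}

def VK {F : Type*} [Field F] (K : RatFunc F) : Set (RatFunc F) :=
  {g | ∃ r : RatFunc F, g = K * rshift F 1 r - r}

def residualForm {F : Type*} [Field F] (u v : Polynomial F) (r : RatFunc F) : Prop :=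
  ∃ a b q : Polynomial F, a.degree < b.degree ∧ shiftFree b ∧ stronglyPrime b u v ∧
    q ∈ WK F u v ∧ r = RatFunc.mk a b + RatFunc.mk q v

theorem pshift_eq_comp {F : Type*} [Field F] (i : ℤ) (p : Polynomial F) :
    pshift F i p = p.comp (X + C (i : F)) := rfl

theorem pshift_zero {F : Type*} [Field F] (p : Polynomial F) : pshift F 0 p = p := by
  simp [pshift_eq_comp]

theorem pshift_pshift {F : Type*} [Field F] (i j : ℤ) (p : Polynomial F) :
    pshift F i (pshift F j p) = pshift F (i + j) p := by
  simp [pshift_eq_comp, comp_assoc, add_assoc]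

theorem natDegree_pshift {F : Type*} [Field F] (i : ℤ) (p : Polynomial F) :
    (pshift F i p).natDegree = p.natDegree := by
  rw [pshift_eq_comp, natDegree_comp, natDegree_X_add_C, mul_one]

theorem leadingCoeff_pshift {F : Type*} [Field F] (i : ℤ) (p : Polynomial F) :
    (pshift F i p).leadingCoeff = p.leadingCoeff := by
  rw [pshift_eq_comp, leadingCoeff_comp (natDegree_X_add_C (i : F) ▸ one_ne_zero),
    leadingCoeff_X_add_C, one_pow, mul_one]

theorem pshift_ne_zero {F : Type*} [Field F] (i : ℤ) {p : Polynomial F} (hp : p ≠ 0) :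
    pshift F i p ≠ 0 := by
  rwa [← leadingCoeff_ne_zero, leadingCoeff_pshift, leadingCoeff_ne_zero]

theorem shiftReducedPair.isCoprime_pshift {F : Type*} [Field F] {u v : Polynomial F}
    (h : shiftReducedPair u v) (i j : ℤ) : IsCoprime (pshift F i u) (pshift F j v) := by
  have := (h.2.2.2 (j - i)).map (pshift F i).toRingHom
  simpa [pshift_pshift] using this

/-- Iterating `u * σ r = v * r` gives `r * ∏ σⁱ v = (∏ σⁱ u) * σⁿ r`. -/
theorem mul_prod_pshift_eq {F : Type*} [Field F] {u v r : Polynomial F}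
    (h : u * pshift F 1 r = v * r) (n : ℕ) :
    r * ∏ i ∈ Finset.range n, pshift F i v =
      (∏ i ∈ Finset.range n, pshift F i u) * pshift F n r := by
  induction n with
  | zero => simp [pshift_zero]
  | succ n ih =>
    have hn := congrArg (pshift F n) h
    simp only [map_mul, pshift_pshift] at hn
    rw [Finset.prod_range_succ, Finset.prod_range_succ, ← mul_assoc, ih, Nat.cast_succ,
      mul_assoc, mul_assoc, hn, mul_comm (pshift F n r)]

/-- A nonzero polynomial solution of `u * σ r = v * r` forces `u` to be constant. -/
theorem shiftReducedPair.natDegree_eq_zero {F : Type*} [Field F] {u v r : Polynomial F}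
    (huv : shiftReducedPair u v) (hr : r ≠ 0) (h : u * pshift F 1 r = v * r) :
    u.natDegree = 0 := by
  have hdvd (n : ℕ) : (∏ i ∈ Finset.range n, pshift F i u) ∣ r := by
    refine IsCoprime.dvd_of_dvd_mul_right ?_ (Dvd.intro _ (mul_prod_pshift_eq h n).symm)
    exact IsCoprime.prod_left fun i _ => IsCoprime.prod_right fun j _ =>
      huv.isCoprime_pshift i j
  have hdeg := natDegree_le_of_dvd (hdvd (r.natDegree + 1)) hr
  rw [natDegree_prod _ _ fun i _ => pshift_ne_zero _ huv.1] at hdeg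
  simp only [natDegree_pshift, Finset.sum_const, Finset.card_range, smul_eq_mul] at hdeg
  by_contra hu
  have := Nat.le_mul_of_pos_right (r.natDegree + 1) (Nat.pos_of_ne_zero hu)
  omega

/-- Let f ∈ F(y) be shift-reduced with f ≠ 1. If a polynomial r ∈ F[y]
satisfies f·σ(r) − r = 0, then r = 0. -/
theorem stmt0 {F : Type*} [Field F] [CharZero F] (u v : Polynomial F)
    (hsr : shiftReducedPair u v) (hf1 : RatFunc.mk u v ≠ 1) (r : Polynomial F)
    (h : RatFunc.mk u v * algebraMap (Polynomial F) (RatFunc F) (pshift F 1 r)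
        - algebraMap (Polynomial F) (RatFunc F) r = 0) :
    r = 0 := by
  by_contra hr
  have hv := hsr.2.1
  have hv' : algebraMap (Polynomial F) (RatFunc F) v ≠ 0 := RatFunc.algebraMap_ne_zero hv
  have heq : u * pshift F 1 r = v * r := by
    apply RatFunc.algebraMap_injective F
    rw [RatFunc.mk_eq_div, sub_eq_zero, div_mul_eq_mul_div, div_eq_iff hv'] at h
    rw [map_mul, map_mul, h, mul_comm]
  have hu := hsr.natDegree_eq_zero hr heq
  have hlc : u.leadingCoeff = v.leadingCoeff := by
    have := congrArg leadingCoeff heq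
    rw [leadingCoeff_mul, leadingCoeff_mul, leadingCoeff_pshift] at this
    exact mul_right_cancel₀ (leadingCoeff_ne_zero.mpr hr) this
  have hvdeg : v.natDegree = 0 := by
    have := congrArg natDegree heq
    rw [natDegree_mul hsr.1 (pshift_ne_zero 1 hr), natDegree_mul hv hr, natDegree_pshift] at this
    omega
  have huv : u = v := by
    rw [eq_C_of_natDegree_eq_zero hu, eq_C_of_natDegree_eq_zero hvdeg]
    simpa [leadingCoeff, hu, hvdeg] using hlc
  exact hf1 (by rw [huv, RatFunc.mk_eq_div, div_self hv'])
end

section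
/- Let K = u/v be shift-reduced with K ≠ 1. Then F[y] is the direct sum of the image of φ_K and W_K as F-vector spaces: im(φ_K) ∩ W_K = {0} and im(φ_K) + W_K = F[y]. -/
open Polynomial

theorem coeff_eq_zero_of_mem_span_X_pow {R : Type*} [Semiring R] {L : Set ℕ} {p : R[X]}
    (hp : p ∈ Submodule.span R {q : R[X] | ∃ n : ℕ, q = X ^ n ∧ n ∈ L}) {m : ℕ} (hm : m ∉ L) :
    p.coeff m = 0 := by
  induction hp using Submodule.span_induction with
  | mem q hq =>
    obtain ⟨n, rfl, hn⟩ := hq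
    rw [coeff_X_pow, if_neg]
    rintro rfl
    exact hm hn
  | zero => simp
  | add q r _ _ hq hr => rw [coeff_add, hq, hr, add_zero]
  | smul a q _ hq => rw [coeff_smul, hq, smul_zero]

/-- A subspace of polynomials containing, for every `n`, a polynomial of exact degree `n`
is everything. -/
theorem submodule_eq_top_of_forall_exists_natDegree_eq {F : Type*} [Field F]
    {T : Submodule F F[X]} (hT : ∀ n : ℕ, ∃ w ∈ T, w ≠ 0 ∧ w.natDegree = n) : T = ⊤ := by
  rw [eq_top_iff]
  rintro p -
  suffices h : ∀ (n : ℕ) (p : F[X]), p.degree < n → p ∈ T from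
    h (p.natDegree + 1) p (degree_le_natDegree.trans_lt (by exact_mod_cast Nat.lt_succ_self _))
  intro n
  induction n with
  | zero =>
    intro p hp
    rw [degree_lt_iff_coeff_zero] at hp
    have : p = 0 := by ext m; exact hp m (Nat.zero_le m)
    exact this ▸ T.zero_mem
  | succ n ih =>
    intro p hp
    obtain ⟨w, hwT, hw0, rfl⟩ := hT n
    have hlt : (p - (p.coeff w.natDegree / w.leadingCoeff) • w).degree < w.natDegree := by
      rw [degree_lt_iff_coeff_zero] at hp ⊢
      intro m hm
      rw [coeff_sub, coeff_smul, smul_eq_mul]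
      rcases hm.eq_or_lt with rfl | hm
      · rw [coeff_natDegree, div_mul_cancel₀ _ (leadingCoeff_ne_zero.mpr hw0), sub_self]
      · rw [hp m hm, coeff_eq_zero_of_natDegree_lt hm, mul_zero, sub_zero]
    simpa using T.add_mem (ih _ hlt) (T.smul_mem (p.coeff w.natDegree / w.leadingCoeff) hwT)

/-- `phiK` as a linear map. -/
noncomputable def phiKLinear {F : Type*} [Field F] (u v : F[X]) : F[X] →ₗ[F] F[X] :=
  LinearMap.mulLeft F u ∘ₗ (pshift F 1).toLinearMap - LinearMap.mulLeft F v

theorem mem_range_phiKLinear {F : Type*} [Field F] {u v p : F[X]} :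
    p ∈ LinearMap.range (phiKLinear u v) ↔ p ∈ Set.range (phiK u v) :=
  Iff.rfl

/-- F[y] = im(φ_K) ⊕ W_K: the intersection is {0} and the sum is F[y]. -/
theorem stmt2 {F : Type*} [Field F] [CharZero F] (u v : Polynomial F)
    (hsr : shiftReducedPair u v) (hK1 : RatFunc.mk u v ≠ 1) :
    (∀ p : Polynomial F, p ∈ Set.range (phiK u v) → p ∈ WK F u v → p = 0) ∧
    (∀ p : Polynomial F, ∃ w ∈ Set.range (phiK u v), ∃ q ∈ WK F u v, p = w + q) := by
  constructor
  · intro p hp hpW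
    by_contra hp0
    exact leadingCoeff_ne_zero.mpr hp0
      (coeff_eq_zero_of_mem_span_X_pow (m := p.natDegree) hpW fun h => h p hp hp0 rfl)
  · intro p
    have htop : LinearMap.range (phiKLinear u v) ⊔ WK F u v = ⊤ := by
      refine submodule_eq_top_of_forall_exists_natDegree_eq fun n => ?_
      by_cases h : ∃ w ∈ Set.range (phiK u v), w ≠ 0 ∧ w.natDegree = n
      · obtain ⟨w, hw, hw'⟩ := h
        exact ⟨w, Submodule.mem_sup_left (mem_range_phiKLinear.mpr hw), hw'⟩
      · refine ⟨X ^ n, Submodule.mem_sup_right (Submodule.subset_span ⟨n, rfl, ?_⟩),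
          pow_ne_zero n X_ne_zero, natDegree_X_pow n⟩
        exact fun w hw hw0 hn => h ⟨w, hw, hw0, hn.symm⟩
    obtain ⟨w, hw, q, hq, hwq⟩ := Submodule.mem_sup.mp (htop ▸ Submodule.mem_top (x := p))
    exact ⟨w, mem_range_phiKLinear.mp hw, q, hq, hwq.symm⟩
end

section
/- Let K = u/v be shift-reduced with K ≠ 1, and let p ∈ F[y]. Then there exists q ∈ W_K such that p/v − q/v belongs to V_K. -/
open Polynomial

theorem phiK_sub {F : Type*} [Field F] (u v s t : Polynomial F) :
    phiK u v (s - t) = phiK u v s - phiK u v t := by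
  simp only [phiK, map_sub]; ring

theorem phiK_smul {F : Type*} [Field F] (u v : Polynomial F) (c : F) (s : Polynomial F) :
    phiK u v (c • s) = c • phiK u v s := by
  simp only [phiK, map_smul, mul_smul_comm, smul_sub]

/-- The range of `phiK u v` together with `WK F u v` spans all polynomials. -/
theorem exists_mem_WK_add_phiK {F : Type*} [Field F] (u v p : Polynomial F) :
    ∃ q ∈ WK F u v, ∃ s, p = q + phiK u v s := by
  suffices h : ∀ n : ℕ, ∀ p : Polynomial F, p.degree < n →
      ∃ q ∈ WK F u v, ∃ s, p = q + phiK u v s from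
    h (p.natDegree + 1) p (degree_lt_iff_coeff_zero _ _ |>.2 fun m hm =>
      coeff_eq_zero_of_natDegree_lt hm)
  intro n
  induction n with
  | zero =>
    intro p hp
    have hp0 : p = 0 := ext fun m => by
      simpa using (degree_lt_iff_coeff_zero _ _).1 hp m (Nat.zero_le m)
    exact ⟨0, zero_mem _, 0, by simp [phiK, hp0]⟩
  | succ n ih =>
    intro p hp
    rw [degree_lt_iff_coeff_zero] at hp
    by_cases hw : ∃ t, phiK u v t ≠ 0 ∧ n = (phiK u v t).natDegree
    · obtain ⟨t, ht0, ht⟩ := hw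
      have hlead : (phiK u v t).coeff n ≠ 0 := by
        rw [ht]; exact leadingCoeff_ne_zero.2 ht0
      obtain ⟨q, hq, s, hs⟩ := ih (p - (p.coeff n / (phiK u v t).coeff n) • phiK u v t) (by
        rw [degree_lt_iff_coeff_zero]
        intro m hm
        rcases hm.eq_or_lt with rfl | hm
        · simp [div_mul_cancel₀ _ hlead]
        · simp [hp m hm, coeff_eq_zero_of_natDegree_lt (ht ▸ hm)])
      refine ⟨q, hq, s - (-(p.coeff n / (phiK u v t).coeff n)) • t, ?_⟩
      rw [phiK_sub, phiK_smul, neg_smul, sub_neg_eq_add, ← add_assoc, ← hs, sub_add_cancel]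
    · have hX : (X ^ n : Polynomial F) ∈ WK F u v := by
        refine Submodule.subset_span ⟨n, rfl, ?_⟩
        rintro _ ⟨t, rfl⟩ ht0 ht
        exact hw ⟨t, ht0, ht⟩
      obtain ⟨q, hq, s, hs⟩ := ih (p - p.coeff n • X ^ n) (by
        rw [degree_lt_iff_coeff_zero]
        intro m hm
        rcases hm.eq_or_lt with rfl | hm
        · simp
        · simp [hp m hm, coeff_X_pow, hm.ne'])
      refine ⟨q + p.coeff n • X ^ n, add_mem hq (Submodule.smul_mem _ _ hX), s, ?_⟩
      rw [add_right_comm, ← hs, sub_add_cancel]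

theorem rshift_algebraMap {F : Type*} [Field F] (i : ℤ) (s : Polynomial F) :
    rshift F i (algebraMap (Polynomial F) (RatFunc F) s) =
      algebraMap (Polynomial F) (RatFunc F) (pshift F i s) := by
  simp [rshift]

theorem mk_phiK {F : Type*} [Field F] (u : Polynomial F) {v : Polynomial F} (hv : v ≠ 0)
    (s : Polynomial F) :
    RatFunc.mk (phiK u v s) v = RatFunc.mk u v *
      rshift F 1 (algebraMap (Polynomial F) (RatFunc F) s) -
        algebraMap (Polynomial F) (RatFunc F) s := by
  have hv' : algebraMap (Polynomial F) (RatFunc F) v ≠ 0 := RatFunc.algebraMap_ne_zero hv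
  rw [rshift_algebraMap]
  simp only [RatFunc.mk_eq_div, phiK, map_sub, map_mul]
  field_simp

/-- For every p ∈ F[y] there is q ∈ W_K with p/v − q/v ∈ V_K. -/
theorem stmt4 {F : Type*} [Field F] [CharZero F] (u v p : Polynomial F)
    (hsr : shiftReducedPair u v) (hK1 : RatFunc.mk u v ≠ 1) :
    ∃ q ∈ WK F u v, RatFunc.mk p v - RatFunc.mk q v ∈ VK (RatFunc.mk u v) := by
  obtain ⟨q, hq, s, rfl⟩ := exists_mem_WK_add_phiK u v p
  refine ⟨q, hq, algebraMap (Polynomial F) (RatFunc F) s, ?_⟩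
  rw [← mk_phiK u hsr.2.1]
  simp only [RatFunc.mk_eq_div, map_add]
  ring
end

section
/- Let K = u/v be shift-reduced with K ≠ 1, and set α₁ = deg(u), β = deg(v − u). If β < α₁ − 1, then deg(φ_K(p)) = β for every nonzero constant p ∈ F, deg(φ_K(p)) = α₁ + deg(p) − 1 for every p ∈ F[y] with deg(p) ≥ 1, W_K is the F-linear span of {y^j : 0 ≤ j ≤ α₁ − 1, j ≠ β}, and dim_F(W_K) = α₁ − 1. -/
open Polynomial

theorem pshift_eq_taylor {F : Type*} [Field F] (i : ℤ) (p : F[X]) :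
    pshift F i p = taylor (i : F) p := by
  simp [pshift, taylor_apply, aeval_def, comp, algebraMap_eq]

theorem coeff_taylor_one_natDegree_sub_one {R : Type*} [CommRing R] (p : R[X])
    (hp : 1 ≤ p.natDegree) :
    (taylor 1 p).coeff (p.natDegree - 1) =
      p.coeff (p.natDegree - 1) + p.natDegree * p.leadingCoeff := by
  obtain ⟨n, hn⟩ : ∃ n, p.natDegree = n + 1 := ⟨p.natDegree - 1, by omega⟩
  have hdeg : (hasseDeriv n p).natDegree < 2 :=
    (natDegree_hasseDeriv_le p n).trans_lt (by omega)
  rw [taylor_coeff, leadingCoeff, hn, Nat.add_sub_cancel, eval_eq_sum_range' hdeg]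
  simp [Finset.sum_range_succ, hasseDeriv_coeff, add_comm 1 n]

theorem natDegree_taylor_one_sub_self {R : Type*} [CommRing R] [IsDomain R] [CharZero R]
    (p : R[X]) (hp : 1 ≤ p.natDegree) :
    (taylor 1 p - p).natDegree = p.natDegree - 1 := by
  have hp0 : p ≠ 0 := by
    rintro rfl
    simp at hp
  have hcoeff : (taylor 1 p - p).coeff (p.natDegree - 1) ≠ 0 := by
    rw [coeff_sub, coeff_taylor_one_natDegree_sub_one p hp, add_sub_cancel_left]
    exact mul_ne_zero (Nat.cast_ne_zero.2 (by omega)) (leadingCoeff_ne_zero.2 hp0)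
  have hne : taylor 1 p - p ≠ 0 := by
    intro h
    simp [h] at hcoeff
  have hlt : (taylor 1 p - p).natDegree < p.natDegree := by
    refine natDegree_lt_natDegree hne ?_
    rw [← degree_taylor p (1 : R)]
    exact degree_sub_lt_left (degree_taylor p 1) (by simpa using hp0) (leadingCoeff_taylor 1 p)
  exact le_antisymm (by omega) (le_natDegree_of_ne_zero hcoeff)

theorem phiK_eq {F : Type*} [Field F] (u v p : F[X]) :
    phiK u v p = u * (taylor 1 p - p) - (v - u) * p := by
  rw [phiK, pshift_eq_taylor, Int.cast_one]
  ring

theorem phiK_C {F : Type*} [Field F] (u v : F[X]) (c : F) :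
    phiK u v (C c) = C (-c) * (v - u) := by
  rw [phiK_eq, taylor_C, C_neg]
  ring

theorem natDegree_phiK_C {F : Type*} [Field F] (u v : F[X]) {c : F} (hc : c ≠ 0) :
    (phiK u v (C c)).natDegree = (v - u).natDegree := by
  rw [phiK_C, natDegree_C_mul (neg_ne_zero.2 hc)]

theorem natDegree_phiK {F : Type*} [Field F] [CharZero F] (u v p : F[X])
    (h : (v - u).natDegree + 1 < u.natDegree) (hp : 1 ≤ p.natDegree) :
    (phiK u v p).natDegree = u.natDegree + p.natDegree - 1 := by
  have hu : u ≠ 0 := by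
    rintro rfl
    simp at h
  have hd := natDegree_taylor_one_sub_self p hp
  have hne : taylor 1 p - p ≠ 0 := by
    intro h0
    have hc := coeff_taylor_one_natDegree_sub_one p hp
    rw [sub_eq_zero.1 h0, left_eq_add, mul_eq_zero, Nat.cast_eq_zero,
      leadingCoeff_eq_zero] at hc
    rcases hc with hc | rfl
    · omega
    · simp at hp
  have hmul : (u * (taylor 1 p - p)).natDegree = u.natDegree + (p.natDegree - 1) := by
    rw [natDegree_mul hu hne, hd]
  have hle : ((v - u) * p).natDegree ≤ (v - u).natDegree + p.natDegree := natDegree_mul_le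
  rw [phiK_eq, natDegree_sub_eq_left_of_natDegree_lt (by omega), hmul]
  omega

theorem finrank_span_X_pow {R : Type*} [CommRing R] [Nontrivial R] (s : Finset ℕ) :
    Module.finrank R (Submodule.span R ((fun j : ℕ => (X : R[X]) ^ j) '' s)) = s.card := by
  have hli : LinearIndependent R (fun j : ℕ => (X : R[X]) ^ j) := by
    simpa [← X_pow_eq_monomial] using (basisMonomials R).linearIndependent
  have hs : LinearIndependent R (fun j : s => (X : R[X]) ^ (j : ℕ)) :=
    hli.comp _ Subtype.val_injective
  have := finrank_span_eq_card hs
  rw [Fintype.card_coe] at this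
  rw [← this, Set.image_eq_range]
  rfl

/-- Case β < α₁ − 1. -/
theorem stmt8 {F : Type*} [Field F] [CharZero F] (u v : Polynomial F)
    (hsr : shiftReducedPair u v) (hK1 : RatFunc.mk u v ≠ 1)
    (hcase : ((v - u).natDegree : ℤ) < (u.natDegree : ℤ) - 1) :
    (∀ p : Polynomial F, p ≠ 0 → p.natDegree = 0 →
        (phiK u v p).natDegree = (v - u).natDegree) ∧
    (∀ p : Polynomial F, 1 ≤ p.natDegree →
        (phiK u v p).natDegree = u.natDegree + p.natDegree - 1) ∧
    WK F u v = Submodule.span F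
      {q : Polynomial F | ∃ j : ℕ, (j : ℤ) ≤ (u.natDegree : ℤ) - 1 ∧
        j ≠ (v - u).natDegree ∧ q = X ^ j} ∧
    Module.finrank F (WK F u v) = u.natDegree - 1 := by
  have hlt : (v - u).natDegree + 1 < u.natDegree := by omega
  have hvu : v - u ≠ 0 := by
    intro h
    apply hK1
    rw [sub_eq_zero.1 h, RatFunc.mk_eq_div, div_self]
    simpa using hsr.1
  have hconst : ∀ p : F[X], p ≠ 0 → p.natDegree = 0 →
      (phiK u v p).natDegree = (v - u).natDegree := by
    intro p hp hp0
    rw [eq_C_of_natDegree_eq_zero hp0] at hp ⊢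
    exact natDegree_phiK_C u v (C_ne_zero.1 hp)
  have hpos := fun p => natDegree_phiK u v p hlt
  have hset : {q : F[X] | ∃ ℓ : ℕ, q = X ^ ℓ ∧
      ∀ w : F[X], w ∈ Set.range (phiK u v) → w ≠ 0 → ℓ ≠ w.natDegree} =
      {q : F[X] | ∃ j : ℕ, (j : ℤ) ≤ (u.natDegree : ℤ) - 1 ∧
        j ≠ (v - u).natDegree ∧ q = X ^ j} := by
    ext q
    constructor
    · rintro ⟨ℓ, rfl, hℓ⟩
      refine ⟨ℓ, ?_, ?_, rfl⟩
      · by_contra hge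
        have hd := hpos (X ^ (ℓ - u.natDegree + 1)) (by simp)
        rw [natDegree_X_pow] at hd
        refine hℓ _ ⟨_, rfl⟩ (fun h0 => ?_) (by rw [hd]; omega)
        rw [h0, natDegree_zero] at hd
        omega
      · rw [← natDegree_phiK_C u v one_ne_zero]
        refine hℓ _ ⟨_, rfl⟩ ?_
        rw [phiK_C]
        exact mul_ne_zero (by simp) hvu
    · rintro ⟨j, hj, hjβ, rfl⟩
      refine ⟨j, rfl, ?_⟩
      rintro _ ⟨p, rfl⟩ hw
      rcases Nat.eq_zero_or_pos p.natDegree with hp | hp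
      · rwa [hconst p (by rintro rfl; simp [phiK] at hw) hp]
      · rw [hpos p hp]
        omega
  refine ⟨hconst, hpos, by rw [WK, hset], ?_⟩
  have himage : {q : F[X] | ∃ j : ℕ, (j : ℤ) ≤ (u.natDegree : ℤ) - 1 ∧
      j ≠ (v - u).natDegree ∧ q = X ^ j} =
      (fun j : ℕ => (X : F[X]) ^ j) ''
        ((Finset.range u.natDegree).erase (v - u).natDegree : Finset ℕ) := by
    ext q
    constructor
    · rintro ⟨j, hj, hjβ, rfl⟩
      exact ⟨j, by simp [hjβ]; omega, rfl⟩
    · rintro ⟨j, hj, rfl⟩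
      simp only [Finset.coe_erase, Finset.coe_range, Set.mem_sdiff, Set.mem_Iio,
        Set.mem_singleton_iff] at hj
      exact ⟨j, by omega, hj.2, rfl⟩
  rw [WK, hset, himage, finrank_span_X_pow,
    Finset.card_erase_of_mem (Finset.mem_range.2 (by omega)), Finset.card_range]
end
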